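/- arXiv:math/0612297 — 2 statements merged into one kernel-verified Lean document; each statement's English description precedes it below -/
import Mathlib

section
/- For every integer n ≥ 8 there exists a unique f₃ ∈ C^∞((0,∞)) satisfying f₃''(r) + ((n-1)/r)·f₃'(r) + (n(n+2)·U(r)^{4/(n-2)} − 3(n+1)/r²)·f₃(r) = −r³·U(r) on (0,∞) with lim_{r→0} f₃(r) = lim_{r→∞} f₃(r) = 0. Moreover, for some positive constant C depending only on n, 0 ≤ f₃(r) ≤ C·r^{5/2}·(1+r)^{9/2−n} for all r > 0. -/
open Set Filter

/-- The standard bubble `U(r) = (1 + r²)^{-(n-2)/2}`. -/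
noncomputable def U (n : ℕ) (r : ℝ) : ℝ := (1 + r ^ 2) ^ (-(((n : ℝ) - 2) / 2))

/-- `f` is a smooth solution of
`f'' + ((n-1)/r) f' + (n(n+2) U^{4/(n-2)} − 3(n+1)/r²) f = −r³ U` on `(0,∞)`
with `f(r) → 0` as `r → 0⁺` and as `r → ∞`. -/
def IsSolF3 (n : ℕ) (f : ℝ → ℝ) : Prop :=
  ContDiffOn ℝ (⊤ : ℕ∞) f (Ioi 0) ∧
  (∀ r ∈ Ioi (0 : ℝ),
    deriv (deriv f) r + ((n : ℝ) - 1) / r * deriv f r +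
      ((n : ℝ) * ((n : ℝ) + 2) * U n r ^ ((4 : ℝ) / ((n : ℝ) - 2))
          - 3 * ((n : ℝ) + 1) / r ^ 2) * f r
      = -(r ^ 3 * U n r)) ∧
  Tendsto f (nhdsWithin 0 (Ioi 0)) (nhds 0) ∧
  Tendsto f atTop (nhds 0)

theorem U_rpow {n : ℕ} (hn : 3 ≤ n) (r : ℝ) :
    U n r ^ ((4 : ℝ) / ((n : ℝ) - 2)) = 1 / (1 + r ^ 2) ^ 2 := by
  have hn' : (3 : ℝ) ≤ n := by exact_mod_cast hn
  have h2 : (n : ℝ) - 2 ≠ 0 := by linarith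
  have h : -(((n : ℝ) - 2) / 2) * (4 / ((n : ℝ) - 2)) = -(2 : ℕ) := by
    push_cast; field_simp; norm_num
  rw [U, ← Real.rpow_mul (by positivity), h, Real.rpow_neg (by positivity), Real.rpow_natCast,
    one_div]

theorem hasDerivAt_one_add_sq_rpow (p r : ℝ) :
    HasDerivAt (fun s : ℝ => (1 + s ^ 2) ^ p) (2 * p * r / (1 + r ^ 2) * (1 + r ^ 2) ^ p) r := by
  have h1 : HasDerivAt (fun s : ℝ => 1 + s ^ 2) (2 * r) r := by
    simpa using (hasDerivAt_pow 2 r).const_add 1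
  have hpos : 0 < 1 + r ^ 2 := by positivity
  convert h1.rpow_const (p := p) (Or.inl hpos.ne') using 1
  rw [Real.rpow_sub_one hpos.ne']
  field_simp

/-- A continuous function on `(0,∞)` which vanishes at both ends and takes a positive value has
a positive local maximum. -/
theorem exists_isLocalMax_of_tendsto_zero {q : ℝ → ℝ} (hc : ContinuousOn q (Ioi 0))
    (h0 : Tendsto q (nhdsWithin 0 (Ioi 0)) (nhds 0)) (hinf : Tendsto q atTop (nhds 0))
    {r₀ : ℝ} (hr₀ : 0 < r₀) (hq : 0 < q r₀) :
    ∃ r, 0 < r ∧ 0 < q r ∧ IsLocalMax q r := by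
  obtain ⟨δ, hδ, hδq⟩ := mem_nhdsGT_iff_exists_Ioo_subset.1 (h0.eventually_lt_const hq)
  obtain ⟨R, hR⟩ := eventually_atTop.1 (hinf.eventually_lt_const hq)
  have hδ' : 0 < δ := hδ
  have hle : δ ≤ r₀ := by
    by_contra! h
    have hlt : q r₀ < q r₀ := hδq ⟨hr₀, h⟩
    exact lt_irrefl _ hlt
  have hge : r₀ < R := by
    by_contra! h
    exact lt_irrefl _ (hR r₀ h)
  obtain ⟨r, hr, hmax⟩ := isCompact_Icc.exists_isMaxOn (s := Icc δ R) ⟨r₀, hle, hge.le⟩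
    (hc.mono fun x hx => hδ'.trans_le hx.1)
  have hr0 : 0 < r := hδ'.trans_le hr.1
  have hqr : q r₀ ≤ q r := hmax ⟨hle, hge.le⟩
  refine ⟨r, hr0, hq.trans_le hqr, ?_⟩
  filter_upwards [Ioi_mem_nhds hr0] with s hs
  rcases lt_or_ge s δ with h | h
  · exact (le_of_lt (hδq ⟨hs, h⟩)).trans hqr
  rcases le_or_gt s R with h' | h'
  · exact hmax ⟨h, h'⟩
  · exact (hR s h'.le).le.trans hqr

theorem IsLocalMax.not_deriv_deriv_pos {q : ℝ → ℝ} {r : ℝ} (h : IsLocalMax q r)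
    (hc : ContinuousAt q r) : ¬ 0 < deriv (deriv q) r := by
  intro hpos
  have hmin := isLocalMin_of_deriv_deriv_pos hpos h.deriv_eq_zero hc
  have heq : q =ᶠ[nhds r] fun _ => q r := by
    filter_upwards [h, hmin] with s h1 h2 using le_antisymm h1 h2
  have := heq.deriv.deriv_eq
  simp at this
  linarith

/-- The reciprocal `r^n (1 + r²)^{-(n+2)/2}` of a strict supersolution of the operator in
`IsSolF3`. -/
noncomputable def weight (n : ℕ) (r : ℝ) : ℝ := r ^ n * (1 + r ^ 2) ^ (-(((n : ℝ) + 2) / 2))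

theorem weight_pos (n : ℕ) {r : ℝ} (hr : 0 < r) : 0 < weight n r := by
  unfold weight; positivity

theorem weight_le_one (n : ℕ) {r : ℝ} (hr : 0 < r) : weight n r ≤ 1 := by
  have h1 : r ^ n ≤ (1 + r ^ 2) ^ ((n : ℝ) / 2) := by
    calc r ^ n = (r ^ 2) ^ ((n : ℝ) / 2) := by
          rw [← Real.rpow_natCast r 2, ← Real.rpow_mul hr.le, ← Real.rpow_natCast]
          congr 1; push_cast; ring
      _ ≤ _ := Real.rpow_le_rpow (by positivity) (by linarith) (by positivity)
  calc weight n r ≤ (1 + r ^ 2) ^ ((n : ℝ) / 2) * (1 + r ^ 2) ^ (-(((n : ℝ) + 2) / 2)) := by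
        unfold weight; gcongr
    _ = (1 + r ^ 2) ^ (-1 : ℝ) := by
        rw [← Real.rpow_add (by positivity)]; congr 1; ring
    _ ≤ 1 := Real.rpow_le_one_of_one_le_of_nonpos (by nlinarith) (by norm_num)

theorem hasDerivAt_weight (n : ℕ) {r : ℝ} (hr : 0 < r) :
    HasDerivAt (weight n) ((n / r - (n + 2) * r / (1 + r ^ 2)) * weight n r) r := by
  have hpos : 0 < 1 + r ^ 2 := by positivity
  have hp : (n : ℝ) * r ^ (n - 1) = n / r * r ^ n := by
    rcases n with _ | n
    · simp
    · simp only [Nat.add_sub_cancel, pow_succ]; field_simp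
  refine ((hasDerivAt_pow n r).mul
    (hasDerivAt_one_add_sq_rpow (-(((n : ℝ) + 2) / 2)) r)).congr_deriv ?_
  rw [hp, weight]
  ring

theorem deriv_deriv_weight_mul {n : ℕ} {d : ℝ → ℝ} (hd : ContDiffOn ℝ (⊤ : ℕ∞) d (Ioi 0))
    {r : ℝ} (hr : 0 < r) (hcrit : deriv (fun s => weight n s * d s) r = 0)
    (hode : deriv (deriv d) r + ((n : ℝ) - 1) / r * deriv d r +
      ((n : ℝ) * (n + 2) * (1 / (1 + r ^ 2) ^ 2) - 3 * ((n : ℝ) + 1) / r ^ 2) * d r = 0) :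
    deriv (deriv fun s => weight n s * d s) r = (n + 3) / r ^ 2 * (weight n r * d r) := by
  have hpos : 0 < 1 + r ^ 2 := by positivity
  have hd1 : ∀ s, 0 < s → HasDerivAt d (deriv d s) s := fun s hs =>
    ((hd.differentiableOn (by simp)).differentiableAt (Ioi_mem_nhds hs)).hasDerivAt
  have hd2 : HasDerivAt (deriv d) (deriv (deriv d) r) r :=
    (((hd.deriv_of_isOpen (m := 1) isOpen_Ioi (by
      norm_cast)).differentiableOn (by simp)).differentiableAt
        (Ioi_mem_nhds hr)).hasDerivAt
  have hq1 : ∀ s, 0 < s → HasDerivAt (fun s => weight n s * d s)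
      (weight n s * ((n / s - (n + 2) * s / (1 + s ^ 2)) * d s + deriv d s)) s := fun s hs => by
    refine ((hasDerivAt_weight n hs).mul (hd1 s hs)).congr_deriv ?_
    ring
  rw [(hq1 r hr).deriv] at hcrit
  have hcrit' := (mul_eq_zero.1 hcrit).resolve_left (weight_pos n hr).ne'
  have ha : HasDerivAt (fun s : ℝ => n / s - (n + 2) * s / (1 + s ^ 2))
      (-n / r ^ 2 - (n + 2) * (1 - r ^ 2) / (1 + r ^ 2) ^ 2) r := by
    have h1 : HasDerivAt (fun s : ℝ => 1 + s ^ 2) (2 * r) r := by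
      simpa using (hasDerivAt_pow 2 r).const_add 1
    refine (((hasDerivAt_const r (n : ℝ)).div (hasDerivAt_id r) hr.ne').sub
      (((hasDerivAt_id r).const_mul ((n : ℝ) + 2)).div h1 hpos.ne')).congr_deriv ?_
    simp only [id]
    field_simp
    ring
  have hq2 := (hasDerivAt_weight n hr).mul ((ha.mul (hd1 r hr)).add hd2)
  have heq : deriv (fun s => weight n s * d s) =ᶠ[nhds r]
      fun s => weight n s * ((n / s - (n + 2) * s / (1 + s ^ 2)) * d s + deriv d s) := by
    filter_upwards [Ioi_mem_nhds hr] with s hs using (hq1 s hs).deriv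
  rw [heq.deriv_eq]
  refine hq2.deriv.trans ?_
  have e1 : deriv d r = -((n / r - (n + 2) * r / (1 + r ^ 2)) * d r) := by linarith
  have e2 : deriv (deriv d) r = -(((n : ℝ) - 1) / r * deriv d r +
      ((n : ℝ) * (n + 2) * (1 / (1 + r ^ 2) ^ 2) - 3 * ((n : ℝ) + 1) / r ^ 2) * d r) := by linarith
  simp only [Pi.add_apply, Pi.mul_apply]
  rw [e2, e1]
  field_simp
  ring

/-- Maximum principle for the homogeneous equation. -/
theorem homogeneous_nonpos {n : ℕ} {d : ℝ → ℝ} (hd : ContDiffOn ℝ (⊤ : ℕ∞) d (Ioi 0))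
    (hode : ∀ r ∈ Ioi (0 : ℝ), deriv (deriv d) r + ((n : ℝ) - 1) / r * deriv d r +
      ((n : ℝ) * (n + 2) * (1 / (1 + r ^ 2) ^ 2) - 3 * ((n : ℝ) + 1) / r ^ 2) * d r = 0)
    (h0 : Tendsto d (nhdsWithin 0 (Ioi 0)) (nhds 0)) (hinf : Tendsto d atTop (nhds 0))
    {r : ℝ} (hr : 0 < r) : d r ≤ 0 := by
  by_contra! hdr
  have hbound : ∀ s, 0 < s → ‖weight n s * d s‖ ≤ ‖d s‖ := fun s hs => by
    rw [norm_mul, Real.norm_of_nonneg (weight_pos n hs).le]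
    exact mul_le_of_le_one_left (norm_nonneg _) (weight_le_one n hs)
  have hc : ContinuousOn (fun s => weight n s * d s) (Ioi 0) :=
    ContinuousOn.mul (fun s hs => (hasDerivAt_weight n hs).continuousAt.continuousWithinAt)
      hd.continuousOn
  obtain ⟨s, hs, hqs, hmax⟩ := exists_isLocalMax_of_tendsto_zero hc
    (squeeze_zero_norm' (eventually_mem_nhdsWithin.mono hbound) (by simpa using h0.norm))
    (squeeze_zero_norm' ((eventually_gt_atTop 0).mono hbound) (by simpa using hinf.norm))
    hr (mul_pos (weight_pos n hr) hdr)
  refine hmax.not_deriv_deriv_pos (hc.continuousAt (Ioi_mem_nhds hs)) ?_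
  rw [deriv_deriv_weight_mul hd hs hmax.deriv_eq_zero (hode s hs)]
  have : 0 < s := hs
  positivity

theorem IsSolF3.le {n : ℕ} (hn : 3 ≤ n) {f g : ℝ → ℝ} (hf : IsSolF3 n f) (hg : IsSolF3 n g)
    {r : ℝ} (hr : 0 < r) : f r ≤ g r := by
  obtain ⟨hf1, hf2, hf3, hf4⟩ := hf
  obtain ⟨hg1, hg2, hg3, hg4⟩ := hg
  have hD : ∀ {φ : ℝ → ℝ}, ContDiffOn ℝ (⊤ : ℕ∞) φ (Ioi 0) → ∀ s, 0 < s →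
      DifferentiableAt ℝ φ s ∧ DifferentiableAt ℝ (deriv φ) s := fun hφ s hs =>
    ⟨(hφ.differentiableOn (by simp)).differentiableAt (Ioi_mem_nhds hs),
      ((hφ.deriv_of_isOpen (m := 1) isOpen_Ioi (by
        norm_cast)).differentiableOn (by simp)).differentiableAt
          (Ioi_mem_nhds hs)⟩
  have key := homogeneous_nonpos (n := n) (hf1.sub hg1) (fun s hs => ?_)
    (by simpa using hf3.sub hg3) (by simpa using hf4.sub hg4) hr
  · simpa using key
  · have heq : deriv (f - g) =ᶠ[nhds s] deriv f - deriv g := by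
      filter_upwards [Ioi_mem_nhds hs] with t ht
      exact deriv_sub (hD hf1 t ht).1 (hD hg1 t ht).1
    have e1 : deriv (deriv (f - g)) s = deriv (deriv f) s - deriv (deriv g) s := by
      rw [heq.deriv_eq, deriv_sub (hD hf1 s hs).2 (hD hg1 s hs).2]
    have ef := hf2 s hs
    have eg := hg2 s hs
    rw [U_rpow hn] at ef eg
    change deriv (deriv (f - g)) s + _ * deriv (f - g) s + _ * (f s - g s) = 0
    rw [e1, heq.eq_of_nhds, Pi.sub_apply]
    linear_combination ef - eg

/-- The coefficient of `r⁴` in the polynomial factor of the explicit solution. -/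
noncomputable def coeffC (n : ℝ) : ℝ := 1 / (8 * (n - 4))

/-- The coefficient of `r²` in the polynomial factor of the explicit solution. -/
noncomputable def coeffB (n : ℝ) : ℝ := (1 / 2 + (n + 8) * coeffC n) / (3 / 2 * (n - 2))

/-- The constant coefficient of the polynomial factor of the explicit solution. -/
noncomputable def coeffA (n : ℝ) : ℝ := (1 / 4 + (3 + n / 2) * coeffB n) / n

/-- The explicit solution `r³ (1 + r²)^{-n/2} (A + B r² + C r⁴)`. -/
noncomputable def solF3 (n : ℕ) (r : ℝ) : ℝ :=
  (1 + r ^ 2) ^ (-((n : ℝ) / 2)) *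
    (coeffA n * r ^ 3 + coeffB n * r ^ 5 + coeffC n * r ^ 7)

theorem contDiff_solF3 (n : ℕ) : ContDiff ℝ (⊤ : ℕ∞) (solF3 n) := by
  refine ContDiff.mul (ContDiff.rpow_const_of_ne (by fun_prop) fun x => ?_) (by fun_prop)
  positivity

theorem solF3_ode {n : ℕ} (hn : 5 ≤ n) {r : ℝ} (hr : 0 < r) :
    deriv (deriv (solF3 n)) r + ((n : ℝ) - 1) / r * deriv (solF3 n) r +
      ((n : ℝ) * ((n : ℝ) + 2) * U n r ^ ((4 : ℝ) / ((n : ℝ) - 2))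
          - 3 * ((n : ℝ) + 1) / r ^ 2) * solF3 n r
      = -(r ^ 3 * U n r) := by
  have hn' : (5 : ℝ) ≤ n := by exact_mod_cast hn
  have hU : U n r = (1 + r ^ 2) * (1 + r ^ 2) ^ (-((n : ℝ) / 2)) := by
    rw [U, show -(((n : ℝ) - 2) / 2) = -((n : ℝ) / 2) + 1 by ring,
      Real.rpow_add_one (by positivity), mul_comm]
  rw [U_rpow (by lia), hU]
  have hA : (n : ℝ) * coeffA n = 1 / 4 + (3 + n / 2) * coeffB n := by
    unfold coeffA; field_simp
  have hB : 3 / 2 * ((n : ℝ) - 2) * coeffB n = 1 / 2 + (n + 8) * coeffC n := by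
    have : (n : ℝ) - 2 ≠ 0 := by linarith
    unfold coeffB; field_simp
  have hC : 8 * ((n : ℝ) - 4) * coeffC n = 1 := by
    have : (n : ℝ) - 4 ≠ 0 := by linarith
    unfold coeffC; field_simp
  unfold solF3
  generalize coeffA n = A at *
  generalize coeffB n = B at *
  generalize coeffC n = C at *
  have hX : ∀ s : ℝ, HasDerivAt (fun s : ℝ => 1 + s ^ 2) (2 * s) s := fun s => by
    simpa using (hasDerivAt_pow 2 s).const_add 1
  have hP : ∀ a b c s : ℝ, ∀ i j k : ℕ,
      HasDerivAt (fun s : ℝ => a * s ^ i + b * s ^ j + c * s ^ k)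
        (a * (i * s ^ (i - 1)) + b * (j * s ^ (j - 1)) + c * (k * s ^ (k - 1))) s :=
    fun a b c s i j k => (((hasDerivAt_pow i s).const_mul a).add
      ((hasDerivAt_pow j s).const_mul b)).add ((hasDerivAt_pow k s).const_mul c)
  have hd1 : deriv (fun s : ℝ => (1 + s ^ 2) ^ (-((n : ℝ) / 2)) *
      (A * s ^ 3 + B * s ^ 5 + C * s ^ 7)) = fun s => (1 + s ^ 2) ^ (-((n : ℝ) / 2)) *
        ((3 * A * s ^ 2 + 5 * B * s ^ 4 + 7 * C * s ^ 6) -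
          (n * A * s ^ 4 + n * B * s ^ 6 + n * C * s ^ 8) / (1 + s ^ 2)) := by
    funext s
    refine ((hasDerivAt_one_add_sq_rpow _ s).mul (hP A B C s 3 5 7)).deriv.trans ?_
    have : 0 < 1 + s ^ 2 := by positivity
    push_cast
    field_simp
    ring
  have hpos : 0 < 1 + r ^ 2 := by positivity
  have hd2 := ((hasDerivAt_one_add_sq_rpow (-((n : ℝ) / 2)) r).mul
    ((hP (3 * A) (5 * B) (7 * C) r 2 4 6).sub
      ((hP (n * A) (n * B) (n * C) r 4 6 8).div (hX r) hpos.ne'))).deriv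
  rw [hd1]
  refine Eq.trans (congrArg₂ (· + ·) (congrArg₂ (· + ·) hd2 rfl) rfl) ?_
  simp only [Pi.sub_apply, Pi.div_apply]
  generalize (1 + r ^ 2) ^ (-((n : ℝ) / 2)) = E
  push_cast
  linear_combination (norm := (field_simp; ring))
    (-4 * E * r ^ 3 / (1 + r ^ 2)) * (hA + r ^ 2 * hB + r ^ 4 / 4 * hC)

theorem coeff_pos {n : ℝ} (hn : 4 < n) : 0 < coeffA n ∧ 0 < coeffB n ∧ 0 < coeffC n := by
  have h4 : 0 < n - 4 := by linarith
  have h2 : 0 < n - 2 := by linarith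
  have h0 : 0 < n := by linarith
  have hC : 0 < coeffC n := by unfold coeffC; positivity
  have hB : 0 < coeffB n := by unfold coeffB; positivity
  refine ⟨?_, hB, hC⟩
  unfold coeffA; positivity

theorem solF3_nonneg {n : ℕ} (hn : 5 ≤ n) {r : ℝ} (hr : 0 < r) : 0 ≤ solF3 n r := by
  obtain ⟨hA, hB, hC⟩ := coeff_pos (n := n) (by exact_mod_cast hn)
  unfold solF3; positivity

theorem solF3_le {n : ℕ} (hn : 5 ≤ n) {r : ℝ} (hr : 0 < r) :
    solF3 n r ≤ (coeffA n + coeffB n + coeffC n) * 2 ^ ((n : ℝ) / 2 - 2) *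
      r ^ ((5 : ℝ) / 2) * (1 + r) ^ ((9 : ℝ) / 2 - (n : ℝ)) := by
  obtain ⟨hA, hB, hC⟩ := coeff_pos (n := n) (by exact_mod_cast hn)
  have hn' : (5 : ℝ) ≤ n := by exact_mod_cast hn
  have hpoly : coeffA n * r ^ 3 + coeffB n * r ^ 5 + coeffC n * r ^ 7 ≤
      (coeffA n + coeffB n + coeffC n) * (1 + r ^ 2) ^ 2 * r ^ 3 := by
    rw [← sub_nonneg]
    ring_nf
    positivity
  have hr3 : r ^ 3 ≤ r ^ ((5 : ℝ) / 2) * (1 + r) ^ ((1 : ℝ) / 2) := by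
    calc r ^ 3 = r ^ ((5 : ℝ) / 2) * r ^ ((1 : ℝ) / 2) := by
          rw [← Real.rpow_add hr, ← Real.rpow_natCast]; norm_num
      _ ≤ _ := by gcongr; linarith
  have hE : (1 + r ^ 2) ^ (2 - (n : ℝ) / 2) ≤ 2 ^ ((n : ℝ) / 2 - 2) * (1 + r) ^ (4 - (n : ℝ)) := by
    calc (1 + r ^ 2) ^ (2 - (n : ℝ) / 2) ≤ ((1 + r) ^ 2 / 2) ^ (2 - (n : ℝ) / 2) := by
          refine Real.rpow_le_rpow_of_nonpos (by positivity) ?_ (by linarith)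
          nlinarith [sq_nonneg (1 - r)]
      _ = _ := by
          rw [Real.div_rpow (by positivity) (by norm_num), ← Real.rpow_natCast (1 + r) 2,
            ← Real.rpow_mul (by positivity), div_eq_mul_inv, ← Real.rpow_neg (by norm_num), mul_comm]
          congr 2
          · ring
          · push_cast; ring
  calc solF3 n r ≤ (1 + r ^ 2) ^ (-((n : ℝ) / 2)) *
        ((coeffA n + coeffB n + coeffC n) * (1 + r ^ 2) ^ 2 * r ^ 3) := by
        unfold solF3; gcongr
    _ = (coeffA n + coeffB n + coeffC n) * (1 + r ^ 2) ^ (2 - (n : ℝ) / 2) * r ^ 3 := by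
        rw [show 2 - (n : ℝ) / 2 = -((n : ℝ) / 2) + (2 : ℕ) by push_cast; ring,
          Real.rpow_add (by positivity), Real.rpow_natCast]
        ring
    _ ≤ (coeffA n + coeffB n + coeffC n) * (2 ^ ((n : ℝ) / 2 - 2) * (1 + r) ^ (4 - (n : ℝ))) *
        (r ^ ((5 : ℝ) / 2) * (1 + r) ^ ((1 : ℝ) / 2)) := by gcongr
    _ = _ := by
        rw [show (9 : ℝ) / 2 - n = (4 - n) + 1 / 2 by ring, Real.rpow_add (by positivity)]
        ring

theorem tendsto_solF3_atTop {n : ℕ} (hn : 8 ≤ n) : Tendsto (solF3 n) atTop (nhds 0) := by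
  have hn' : (8 : ℝ) ≤ n := by exact_mod_cast hn
  obtain ⟨hA, hB, hC⟩ := coeff_pos (n := n) (by linarith)
  set K := (coeffA n + coeffB n + coeffC n) * 2 ^ ((n : ℝ) / 2 - 2) with hK
  have hlim : Tendsto (fun r : ℝ => K * (1 + r) ^ (-((n : ℝ) - 7))) atTop (nhds 0) := by
    simpa using ((tendsto_rpow_neg_atTop (by linarith : 0 < (n : ℝ) - 7)).comp
      (tendsto_atTop_add_const_left _ 1 tendsto_id)).const_mul K
  refine squeeze_zero' ?_ ?_ hlim
  · filter_upwards [eventually_gt_atTop 0] with r hr using solF3_nonneg (by lia) hr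
  · filter_upwards [eventually_gt_atTop 0] with r hr
    refine (solF3_le (by lia) hr).trans ?_
    rw [← hK, show -((n : ℝ) - 7) = 5 / 2 + (9 / 2 - n) by ring, Real.rpow_add (by positivity),
      ← mul_assoc]
    gcongr
    linarith

theorem isSolF3_solF3 {n : ℕ} (hn : 8 ≤ n) : IsSolF3 n (solF3 n) := by
  refine ⟨(contDiff_solF3 n).contDiffOn, fun r hr => solF3_ode (by lia) hr, ?_,
    tendsto_solF3_atTop hn⟩
  have h := (contDiff_solF3 n).continuous.tendsto 0
  rw [show solF3 n 0 = 0 by simp [solF3]] at h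
  exact h.mono_left nhdsWithin_le_nhds

theorem statement5 (n : ℕ) (hn : 8 ≤ n) :
    ∃ f₃ : ℝ → ℝ, IsSolF3 n f₃ ∧
      (∀ g : ℝ → ℝ, IsSolF3 n g → EqOn g f₃ (Ioi 0)) ∧
      ∃ C : ℝ, 0 < C ∧ ∀ r ∈ Ioi (0 : ℝ),
        0 ≤ f₃ r ∧ f₃ r ≤ C * r ^ ((5 : ℝ) / 2) * (1 + r) ^ ((9 : ℝ) / 2 - (n : ℝ)) := by
  have hn' : (8 : ℝ) ≤ n := by exact_mod_cast hn
  obtain ⟨hA, hB, hC⟩ := coeff_pos (n := n) (by linarith)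
  exact ⟨solF3 n, isSolF3_solF3 hn,
    fun g hg r hr => le_antisymm (hg.le (by lia) (isSolF3_solF3 hn) hr)
      ((isSolF3_solF3 hn).le (by lia) hg hr),
    (coeffA n + coeffB n + coeffC n) * 2 ^ ((n : ℝ) / 2 - 2), by positivity,
    fun r hr => ⟨solF3_nonneg (by lia) hr, solF3_le (by lia) hr⟩⟩
end

section
/- Let n ≥ 10 be an integer and set φ₁(r) = r⁴·U(r)/(6(n−4)) for r > 0. Then for all r ∈ (0,∞), φ₁''(r) + ((n-1)/r)·φ₁'(r) + (n(n+2)·U(r)^{4/(n-2)} − 2n/r²)·φ₁(r) = −r²·U(r) + r²·U(r)·( (4(n−2)/(3(n−4)))·(1/(1+r²)) + (2n/(3(n−4)))·r²·U(r)^{4/(n-2)} ). In particular, φ₁''(r) + ((n-1)/r)·φ₁'(r) + (n(n+2)·U(r)^{4/(n-2)} − 2n/r²)·φ₁(r) > −r²·U(r) for all r > 0. -/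
open Set

/-- `φ₁(r) = r⁴ U(r) / (6(n−4))`. -/
noncomputable def phi1 (n : ℕ) (r : ℝ) : ℝ := r ^ 4 * U n r / (6 * ((n : ℝ) - 4))

theorem U_pos (n : ℕ) (r : ℝ) : 0 < U n r :=
  Real.rpow_pos_of_pos (by positivity) _

theorem U_rpow_four_div {n : ℕ} (hn : (n : ℝ) - 2 ≠ 0) (r : ℝ) :
    U n r ^ ((4 : ℝ) / ((n : ℝ) - 2)) = 1 / (1 + r ^ 2) ^ 2 := by
  have h : (0 : ℝ) < 1 + r ^ 2 := by positivity
  rw [U, ← Real.rpow_mul h.le,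
    show -(((n : ℝ) - 2) / 2) * (4 / ((n : ℝ) - 2)) = -(2 : ℕ) by push_cast; field_simp; norm_num,
    Real.rpow_neg h.le, Real.rpow_natCast, one_div]

theorem hasDerivAt_U (n : ℕ) (r : ℝ) :
    HasDerivAt (U n) (-((n : ℝ) - 2) * r / (1 + r ^ 2) * U n r) r := by
  have h : (0 : ℝ) < 1 + r ^ 2 := by positivity
  have hd : HasDerivAt (fun x : ℝ => 1 + x ^ 2) (2 * r) r := by
    simpa using (hasDerivAt_pow 2 r).const_add 1
  refine (hd.rpow_const (p := -(((n : ℝ) - 2) / 2)) (Or.inl h.ne')).congr_deriv ?_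
  rw [U, Real.rpow_sub_one h.ne']
  ring

theorem hasDerivAt_phi1 (n : ℕ) (r : ℝ) :
    HasDerivAt (phi1 n)
      ((4 * r ^ 3 - ((n : ℝ) - 2) * (r ^ 5 / (1 + r ^ 2))) * U n r / (6 * ((n : ℝ) - 4))) r := by
  refine (((hasDerivAt_pow 4 r).mul (hasDerivAt_U n r)).div_const (6 * ((n : ℝ) - 4))).congr_deriv ?_
  push_cast
  ring

theorem deriv_phi1 (n : ℕ) :
    deriv (phi1 n) = fun r =>
      (4 * r ^ 3 - ((n : ℝ) - 2) * (r ^ 5 / (1 + r ^ 2))) * U n r / (6 * ((n : ℝ) - 4)) :=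
  funext fun r => (hasDerivAt_phi1 n r).deriv

theorem deriv_deriv_phi1 (n : ℕ) (r : ℝ) :
    deriv (deriv (phi1 n)) r =
      (12 * r ^ 2 - ((n : ℝ) - 2) * ((5 * r ^ 4 * (1 + r ^ 2) - r ^ 5 * (2 * r)) / (1 + r ^ 2) ^ 2)
        - (4 * r ^ 3 - ((n : ℝ) - 2) * (r ^ 5 / (1 + r ^ 2))) * (((n : ℝ) - 2) * r / (1 + r ^ 2)))
        * U n r / (6 * ((n : ℝ) - 4)) := by
  have h : (0 : ℝ) < 1 + r ^ 2 := by positivity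
  have hd : HasDerivAt (fun x : ℝ => 1 + x ^ 2) (2 * r) r := by
    simpa using (hasDerivAt_pow 2 r).const_add 1
  have hq := ((hasDerivAt_pow 5 r).div hd h.ne').const_mul ((n : ℝ) - 2)
  have hp := ((hasDerivAt_pow 3 r).const_mul 4).sub hq
  rw [deriv_phi1]
  refine HasDerivAt.deriv ?_
  refine ((hp.mul (hasDerivAt_U n r)).div_const (6 * ((n : ℝ) - 4))).congr_deriv ?_
  simp only [Pi.sub_apply, Pi.div_apply]
  push_cast
  ring

/-- for `n ≥ 10`, the function `φ₁(r) = r⁴U(r)/(6(n−4))` satisfies the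
explicit identity
`φ₁'' + ((n-1)/r)φ₁' + (n(n+2)U^{4/(n-2)} − 2n/r²)φ₁
  = −r²U + r²U( (4(n−2)/(3(n−4)))(1/(1+r²)) + (2n/(3(n−4))) r² U^{4/(n-2)} )`
on `(0,∞)`, and in particular it is a strict supersolution:
`φ₁'' + ((n-1)/r)φ₁' + (n(n+2)U^{4/(n-2)} − 2n/r²)φ₁ > −r²U`. -/
theorem statement6 (n : ℕ) (hn : 10 ≤ n) :
    ∀ r ∈ Ioi (0 : ℝ),
      (deriv (deriv (phi1 n)) r + ((n : ℝ) - 1) / r * deriv (phi1 n) r +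
          ((n : ℝ) * ((n : ℝ) + 2) * U n r ^ ((4 : ℝ) / ((n : ℝ) - 2))
            - 2 * (n : ℝ) / r ^ 2) * phi1 n r
        = -(r ^ 2 * U n r) + r ^ 2 * U n r *
            ((4 * ((n : ℝ) - 2) / (3 * ((n : ℝ) - 4))) * (1 / (1 + r ^ 2))
              + (2 * (n : ℝ) / (3 * ((n : ℝ) - 4))) * r ^ 2 *
                  U n r ^ ((4 : ℝ) / ((n : ℝ) - 2)))) ∧
      -(r ^ 2 * U n r) <
        deriv (deriv (phi1 n)) r + ((n : ℝ) - 1) / r * deriv (phi1 n) r +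
          ((n : ℝ) * ((n : ℝ) + 2) * U n r ^ ((4 : ℝ) / ((n : ℝ) - 2))
            - 2 * (n : ℝ) / r ^ 2) * phi1 n r := by
  intro r hr
  have hr : 0 < r := hr
  have hn' : (10 : ℝ) ≤ n := by exact_mod_cast hn
  have h2 : 0 < (n : ℝ) - 2 := by linarith
  have h4 : 0 < (n : ℝ) - 4 := by linarith
  have h : (0 : ℝ) < 1 + r ^ 2 := by positivity
  have hU := U_pos n r
  refine and_iff_left_of_imp (fun heq => ?_) |>.2 ?_
  · rw [heq, U_rpow_four_div h2.ne']
    exact lt_add_of_pos_right _ (by positivity)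
  · rw [deriv_deriv_phi1, deriv_phi1, U_rpow_four_div h2.ne', phi1]
    field_simp
    ring
end
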